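/- (Convergence of the generalized block qd-algorithm, simple spectrum case.) Suppose the discrete non-commutative hungry Toda-II lattice equations with zero boundary conditions hold at every step α ∈ ℕ. Regard J_n^{(0)} as a complex np×np matrix, and suppose J_n^{(0)} = X·D·X^{−1} where D = diag(λ_1,…,λ_{np}) with |λ_1| > |λ_2| > ⋯ > |λ_{np}| > 0, and suppose that for each k = 1,…,n−1 the leading principal kp×kp submatrices of X and of X^{−1} are invertible. Then J_n^{(θα)} converges as α → ∞ to a block upper bidiagonal matrix: every p×p block of J_n^{(θα)} strictly below the block diagonal tends to 0, every block strictly above the block superdiagonal is 0, every block on the block superdiagonal equals I_p, and the diagonal blocks q_m^{(θα)} converge as α → ∞. -/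

import Mathlib

open Matrix Filter

/-- The block upper bidiagonal matrix `R_n^{(α)}`: diagonal blocks
`q_1^{(α)}, …, q_n^{(α)}`, superdiagonal blocks `I_p`, zero elsewhere,
realized as an `np × np` real matrix indexed by `Fin n × Fin p`. -/
def blkR (p n : ℕ) (q : ℕ → ℕ → Matrix (Fin p) (Fin p) ℝ) (α : ℕ) :
    Matrix (Fin n × Fin p) (Fin n × Fin p) ℝ :=
  Matrix.of fun u v =>
    if u.1 = v.1 then q ((u.1 : ℕ) + 1) α u.2 v.2
    else if (v.1 : ℕ) = (u.1 : ℕ) + 1 then (if u.2 = v.2 then 1 else 0) else 0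

/-- The block lower bidiagonal matrix `L_n^{(α)}`: diagonal blocks `I_p`,
subdiagonal blocks `e_1^{(α)}, …, e_{n-1}^{(α)}`, zero elsewhere. -/
def blkL (p n : ℕ) (e : ℕ → ℕ → Matrix (Fin p) (Fin p) ℝ) (α : ℕ) :
    Matrix (Fin n × Fin p) (Fin n × Fin p) ℝ :=
  Matrix.of fun u v =>
    if u.1 = v.1 then (if u.2 = v.2 then 1 else 0)
    else if (u.1 : ℕ) = (v.1 : ℕ) + 1 then e (u.1 : ℕ) α u.2 v.2 else 0

/-- The discrete non-commutative hungry Toda-II lattice with zero boundary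
conditions, at time step `α`. -/
def TodaStep (p θ : ℕ) (q e : ℕ → ℕ → Matrix (Fin p) (Fin p) ℝ) (n α : ℕ) : Prop :=
  (∀ m : ℕ, 1 ≤ m → m ≤ n → q m (α + 1) + e (m - 1) (α + θ) = q m α + e m α) ∧
  (∀ m : ℕ, 1 ≤ m → m ≤ n - 1 → e m (α + θ) * q m (α + 1) = q (m + 1) α * e m α)

/-- The block Hessenberg matrix
`J_n^{(α)} = L_n^{(α)} · L_n^{(α+1)} ⋯ L_n^{(α+θ-1)} · R_n^{(α)}`. -/
def blkJ (p n θ : ℕ) (q e : ℕ → ℕ → Matrix (Fin p) (Fin p) ℝ) (α : ℕ) :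
    Matrix (Fin n × Fin p) (Fin n × Fin p) ℝ :=
  ((List.range θ).map fun i => blkL p n e (α + i)).prod * blkR p n q α

lemma blk_tendsto_mul_adj {ι κ : Type*} [Fintype ι] [Fintype κ] [DecidableEq κ]
    (C : ℕ → Matrix ι κ ℂ) (C1 : ℕ → Matrix κ κ ℂ) (X : Matrix ι κ ℂ) (X1 : Matrix κ κ ℂ)
    (h : Tendsto C atTop (nhds X)) (h1 : Tendsto C1 atTop (nhds X1)) :
    Tendsto (fun k => C k * (C1 k).adjugate) atTop (nhds (X * X1.adjugate)) := by
  have h2 : Tendsto (fun k => (C1 k).adjugate) atTop (nhds X1.adjugate) :=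
    ((continuous_id.matrix_adjugate).tendsto X1).comp h1
  refine tendsto_pi_nhds.2 fun u => tendsto_pi_nhds.2 fun v => ?_
  simp only [Matrix.mul_apply]
  refine tendsto_finsetSum _ fun w _ => ?_
  exact (tendsto_pi_nhds.1 (tendsto_pi_nhds.1 h u) w).mul
    (tendsto_pi_nhds.1 (tendsto_pi_nhds.1 h2 w) v)

lemma blk_conv_aux {ι κ : Type*} [Fintype ι] [DecidableEq ι] [Fintype κ] [DecidableEq κ]
    (f : κ → ι) (X Y : Matrix ι ι ℂ) (lam : ι → ℂ)
    (hlam0 : ∀ u, lam u ≠ 0)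
    (hlam : ∀ u, u ∉ Set.range f → ∀ w, ‖lam u‖ < ‖lam (f w)‖)
    (hf : Function.Injective f)
    (hX : IsUnit (X.submatrix f f)) (hY : IsUnit (Y.submatrix f f))
    (P U : ℕ → Matrix ι ι ℂ)
    (hU : ∀ k u, u ∉ Set.range f → ∀ w, U k u (f w) = 0)
    (hPU : ∀ k, P k * U k = X * diagonal lam ^ k * Y)
    (w : κ) (hw : ∀ k w', P k (f w') (f w) = if w' = w then 1 else 0) (u : ι) :
    ∃ l, Tendsto (fun k => P k u (f w)) atTop (nhds l) := by
  classical
  set Y1 := Y.submatrix f f with hY1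
  set X1 := X.submatrix f f with hX1
  have hYd : IsUnit Y1.det := (Matrix.isUnit_iff_isUnit_det _).1 hY
  have hXd : IsUnit X1.det := (Matrix.isUnit_iff_isUnit_det _).1 hX
  set Z : Matrix ι κ ℂ := Y.submatrix id f * Y1⁻¹ with hZ
  have hZf : ∀ w' v, Z (f w') v = if w' = v then 1 else 0 := by
    intro w' v
    have : (Y1 * Y1⁻¹) w' v = (1 : Matrix κ κ ℂ) w' v := by
      rw [Matrix.mul_nonsing_inv _ hYd]
    rw [Matrix.one_apply] at this
    rw [← this]
    simp [hZ, hY1, Matrix.mul_apply]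
  let G : ℕ → Matrix κ κ ℂ := fun k => Y1⁻¹ * diagonal (fun v => (lam (f v) ^ k)⁻¹)
  let C : ℕ → Matrix ι κ ℂ := fun k => (X * diagonal lam ^ k * Y).submatrix id f * G k
  have hC : ∀ k, C k = X * (diagonal lam ^ k * Z * diagonal (fun v => (lam (f v) ^ k)⁻¹)) := by
    intro k
    have : (X * diagonal lam ^ k * Y).submatrix id f
        = X * diagonal lam ^ k * Y.submatrix id f := by
      ext a b; simp [Matrix.mul_apply]
    simp only [C, G, this, hZ]
    simp only [Matrix.mul_assoc]
  have hCt : Tendsto C atTop (nhds (X.submatrix id f)) := by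
    have h1 : Tendsto (fun k => diagonal lam ^ k * Z * diagonal (fun v => (lam (f v) ^ k)⁻¹))
        atTop (nhds (Matrix.of fun a v => if a = f v then (1 : ℂ) else 0)) := by
      refine tendsto_pi_nhds.2 fun a => tendsto_pi_nhds.2 fun v => ?_
      have h2 : ∀ k, (diagonal lam ^ k * Z * diagonal (fun v => (lam (f v) ^ k)⁻¹)) a v
          = Z a v * (lam a / lam (f v)) ^ k := by
        intro k
        rw [Matrix.mul_diagonal, Matrix.diagonal_pow, Matrix.diagonal_mul, div_pow]
        simp only [Pi.pow_apply]
        ring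
      simp only [h2, Matrix.of_apply]
      by_cases ha : a ∈ Set.range f
      · obtain ⟨w', rfl⟩ := ha
        rw [hZf]
        by_cases h : w' = v
        · subst h
          simp [hlam0]
        · simp [h, hf.eq_iff]
      · have : a ≠ f v := fun h => ha ⟨v, h.symm⟩
        rw [if_neg this]
        have h3 : Tendsto (fun k => (lam a / lam (f v)) ^ k) atTop (nhds 0) := by
          apply tendsto_pow_atTop_nhds_zero_of_norm_lt_one
          rw [norm_div, div_lt_one (norm_pos_iff.2 (hlam0 _))]
          exact hlam a ha v
        simpa using h3.const_mul (Z a v)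
    have h4 : X * (Matrix.of fun a v => if a = f v then (1 : ℂ) else 0) = X.submatrix id f := by
      ext a v; simp [Matrix.mul_apply]
    rw [← h4]
    have h5 : C = fun k => X * (diagonal lam ^ k * Z * diagonal (fun v => (lam (f v) ^ k)⁻¹)) :=
      funext hC
    rw [h5]
    exact ((continuous_const.matrix_mul continuous_id).tendsto _).comp h1
  let C1 : ℕ → Matrix κ κ ℂ := fun k => (C k).submatrix f id
  have hC1t : Tendsto C1 atTop (nhds X1) :=
    ((continuous_id.matrix_submatrix f id).tendsto (X.submatrix id f)).comp hCt
  have hdet : Tendsto (fun k => (C1 k).det) atTop (nhds X1.det) :=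
    ((continuous_id.matrix_det).tendsto X1).comp hC1t
  have hne : ∀ᶠ k in atTop, (C1 k).det ≠ 0 := hdet.eventually_ne hXd.ne_zero
  have hCP : ∀ k, C k = (P k).submatrix id f * ((U k).submatrix f f * G k) := by
    intro k
    rw [← Matrix.mul_assoc]
    simp only [C, ← hPU]
    congr 1
    ext a v
    simp only [Matrix.submatrix_apply, Matrix.mul_apply, id]
    symm
    apply Finset.sum_of_injOn f hf.injOn
    · simp
    · intro i _ hi
      rw [hU k i (by simpa using hi), mul_zero]
    · simp
  have hinv : Tendsto (fun k => (C k * (C1 k).adjugate) ) atTop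
      (nhds (X.submatrix id f * X1.adjugate)) := by
    exact blk_tendsto_mul_adj _ _ _ _ hCt hC1t
  have hfin : Tendsto (fun k => (C1 k).det⁻¹ * (C k * (C1 k).adjugate) u w) atTop
      (nhds (X1.det⁻¹ * (X.submatrix id f * X1.adjugate) u w)) :=
    (hdet.inv₀ hXd.ne_zero).mul ((tendsto_pi_nhds.1 (tendsto_pi_nhds.1 hinv u)) w)
  refine ⟨_, hfin.congr' ?_⟩
  filter_upwards [hne] with k hk
  set T := (U k).submatrix f f * G k with hT
  have hC1k : C1 k = (P k).submatrix f f * T := by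
    simp only [C1, hCP k]
    ext a v; simp [Matrix.mul_apply, hT]
  have hPd : IsUnit ((P k).submatrix f f).det := by
    rw [hC1k, Matrix.det_mul] at hk
    exact (left_ne_zero_of_mul hk).isUnit
  have hTd : IsUnit T.det := by
    rw [hC1k, Matrix.det_mul] at hk
    exact (right_ne_zero_of_mul hk).isUnit
  have e1 : C k * (C1 k)⁻¹ * (P k).submatrix f f = (P k).submatrix id f := by
    rw [hC1k, Matrix.mul_inv_rev, hCP k, ← hT]
    rw [Matrix.mul_assoc, Matrix.mul_assoc T⁻¹, Matrix.nonsing_inv_mul _ hPd, Matrix.mul_one,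
      Matrix.mul_assoc, Matrix.mul_nonsing_inv _ hTd, Matrix.mul_one]
  have e2 := congrFun (congrFun e1 u) w
  rw [Matrix.mul_apply] at e2
  simp only [Matrix.submatrix_apply, hw, id] at e2
  rw [← e2]
  simp [Matrix.inv_def, Ring.inverse_eq_inv']

lemma blk_toda_comm {p n θ : ℕ} {q e : ℕ → ℕ → Matrix (Fin p) (Fin p) ℝ}
    (hbd : ∀ α : ℕ, e 0 α = 0 ∧ e n α = 0)
    (htoda : ∀ α : ℕ, TodaStep p θ q e n α) (α : ℕ) :
    blkL p n e (α + θ) * blkR p n q (α + 1) = blkR p n q α * blkL p n e α := by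
  obtain ⟨h1, h2⟩ := htoda α
  ext ⟨i, a⟩ ⟨j, b⟩
  have hL : ∀ (β : ℕ) (M : Matrix (Fin n × Fin p) (Fin n × Fin p) ℝ) (i : Fin n) (a : Fin p)
      (v), (blkL p n e β * M) (i, a) v = M (i, a) v +
        (if h : 0 < (i : ℕ) then ∑ c, e i β a c * M (⟨i - 1, by omega⟩, c) v else 0) := by
    intro β M i a v
    rw [Matrix.mul_apply, Fintype.sum_prod_type]
    by_cases h : 0 < (i : ℕ)
    · have hne : i ≠ (⟨i - 1, by omega⟩ : Fin n) := by
        intro h'; have := congrArg Fin.val h'; simp at this; omega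
      rw [Finset.sum_eq_add_of_mem i (⟨i - 1, by omega⟩ : Fin n) (Finset.mem_univ _)
        (Finset.mem_univ _) hne]
      · have hi : (i : ℕ) = i - 1 + 1 := by omega
        simp [blkL, h, hne, ← hi]
      · intro c _ hc
        have : ¬ i = c := fun h => hc.1 h.symm
        have h'' : ¬ (i : ℕ) = c + 1 := by
          intro h; apply hc.2; ext; simp; omega
        simp [blkL, this, h'']
    · rw [Finset.sum_eq_single i]
      · simp [blkL, h]
      · intro c _ hc
        have : ¬ i = c := fun h => hc h.symm
        have h'' : ¬ (i : ℕ) = c + 1 := by omega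
        simp [blkL, this, h'']
      · simp
  have hR : ∀ (β : ℕ) (M : Matrix (Fin n × Fin p) (Fin n × Fin p) ℝ) (i : Fin n) (a : Fin p)
      (v), (blkR p n q β * M) (i, a) v = (∑ c, q (i + 1) β a c * M (i, c) v) +
        (if h : (i : ℕ) + 1 < n then M (⟨i + 1, h⟩, a) v else 0) := by
    intro β M i a v
    rw [Matrix.mul_apply, Fintype.sum_prod_type]
    by_cases h : (i : ℕ) + 1 < n
    · have hne : i ≠ (⟨i + 1, h⟩ : Fin n) := by
        intro h'; have := congrArg Fin.val h'; simp at this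
      rw [Finset.sum_eq_add_of_mem i (⟨i + 1, h⟩ : Fin n) (Finset.mem_univ _)
        (Finset.mem_univ _) hne]
      · simp [blkR, h, hne]
      · intro c _ hc
        have : ¬ i = c := fun h => hc.1 h.symm
        have h'' : ¬ (c : ℕ) = i + 1 := by
          intro h; apply hc.2; ext; simp; omega
        simp [blkR, this, h'']
    · rw [Finset.sum_eq_single i]
      · simp [blkR, h]
      · intro c _ hc
        have : ¬ i = c := fun h => hc h.symm
        have h'' : ¬ (c : ℕ) = i + 1 := by omega
        simp [blkR, this, h'']
      · simp
  rw [hL, hR]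
  rcases lt_trichotomy (i : ℕ) j with hij | hij | hij
  · have n1 : ¬ i = j := fun h => by rw [h] at hij; omega
    have n2 : ¬ (i : ℕ) = j + 1 := by omega
    have n3 : ∀ h, ¬ (⟨i - 1, h⟩ : Fin n) = j := fun h h' => by rw [← h'] at hij; simp at hij; omega
    have n4 : ¬ (j : ℕ) = i - 1 + 1 ∨ (i : ℕ) = 0 := by omega
    have n5 : ∀ h, ((⟨i + 1, h⟩ : Fin n) = j ↔ (j : ℕ) = i + 1) := fun h =>
      ⟨fun h' => by rw [← h'], fun h' => by ext; exact h'.symm⟩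
    have n6 : ¬ (i : ℕ) = j := by omega
    have n7 : (j : ℕ) = i + 1 → (i : ℕ) + 1 < n := by omega
    rcases n4 with n4 | n4
    · simp [blkL, blkR, n1, n2, n3, n4, n5, n6]
      grind
    · simp [blkL, blkR, n1, n2, n3, n4, n5, n6]
      grind
  · have hij : i = j := Fin.ext hij
    subst hij
    have hs := congrFun (congrFun (h1 (i + 1) (by omega) (by omega)) a) b
    simp only [Matrix.add_apply, Nat.add_sub_cancel] at hs
    have n1 : ∀ h, ¬ (⟨i + 1, h⟩ : Fin n) = i := fun h h' => by
      have := congrArg Fin.val h'; simp at this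
    have hlast : ¬ (i : ℕ) + 1 < n → e (i + 1) α a b = 0 := by
      intro h
      have : (i : ℕ) + 1 = n := by omega
      rw [this, (hbd α).2]; rfl
    have hfirst : ¬ 0 < (i : ℕ) → e i (α + θ) a b = 0 := by
      intro h
      have : (i : ℕ) = 0 := by omega
      rw [this, (hbd _).1]; rfl
    have t1 : (if h : 0 < (i : ℕ) then ∑ c, e i (α + θ) a c *
        blkR p n q (α + 1) (⟨i - 1, by omega⟩, c) (i, b) else 0) = e i (α + θ) a b := by
      split_ifs with h
      · have n2 : ∀ h, ¬ (⟨i - 1, h⟩ : Fin n) = i := fun h h' => by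
          have := congrArg Fin.val h'; simp at this; omega
        have n3 : (i : ℕ) = i - 1 + 1 := by omega
        simp [blkR, n2, ← n3]
      · exact (hfirst h).symm
    have t2 : (if h : (i : ℕ) + 1 < n then blkL p n e α (⟨i + 1, h⟩, a) (i, b) else 0)
        = e (i + 1) α a b := by
      split_ifs with h
      · simp [blkL, n1]
      · exact (hlast h).symm
    rw [t1, t2]
    simpa [blkL, blkR] using hs
  · have n1 : ¬ i = j := fun h => by rw [h] at hij; omega
    have n2 : ¬ (j : ℕ) = i + 1 := by omega
    have h0 : 0 < (i : ℕ) := by omega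
    have n3 : ∀ h, ¬ (⟨i + 1, h⟩ : Fin n) = j := fun h h' => by rw [← h'] at hij; simp at hij
    have n4 : ¬ (i : ℕ) = j := by omega
    by_cases hj : (i : ℕ) = j + 1
    · have n6 : ¬ (j : ℕ) = j + 1 + 1 := by omega
      have n7 : ∀ h, ¬ (⟨j + 1 + 1, h⟩ : Fin n) = j := fun h h' => by
        have := congrArg Fin.val h'; simp at this; omega
      have hs := congrFun (congrFun (h2 (j + 1) (by omega) (by omega)) a) b
      have n5 : ∀ h, (⟨i - 1, h⟩ : Fin n) = j := fun h => by ext; simp; omega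
      simp only [Matrix.mul_apply] at hs
      simp [blkL, blkR, n1, n6, n7, hj]
      simpa using hs
    · have n5 : ∀ h, ¬ (⟨i - 1, h⟩ : Fin n) = j := fun h h' => by
        have := congrArg Fin.val h'; simp at this; omega
      have n6 : ¬ (j : ℕ) = i - 1 + 1 := by omega
      simp [blkL, blkR, n1, n2, n3, n4, n5, n6, hj]

/-- Block unit lower triangular. -/
def BlkUL {p n : ℕ} (M : Matrix (Fin n × Fin p) (Fin n × Fin p) ℝ) : Prop :=
  ∀ u v : Fin n × Fin p, u.1 ≤ v.1 → M u v = if u = v then 1 else 0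

lemma BlkUL.mul {p n : ℕ} {M N : Matrix (Fin n × Fin p) (Fin n × Fin p) ℝ}
    (hM : BlkUL M) (hN : BlkUL N) : BlkUL (M * N) := by
  intro u v huv
  rw [Matrix.mul_apply]
  have : ∀ w, M u w * N w v = if w = u then (if u = v then 1 else 0) else 0 := by
    intro w
    by_cases h : u.1 ≤ w.1
    · rw [hM u w h]
      by_cases h' : u = w
      · subst h'; simp [hN u v huv]
      · simp [h', Ne.symm h']
    · have h2 : w.1 ≤ v.1 := le_trans (le_of_lt (not_le.1 h)) huv
      have h3 : w ≠ u := by rintro rfl; exact h le_rfl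
      have h4 : w ≠ v := by rintro rfl; exact h huv
      rw [hN w v h2, if_neg h4, if_neg h3, mul_zero]
  simp [this]

lemma BlkUL.one {p n : ℕ} : BlkUL (1 : Matrix (Fin n × Fin p) (Fin n × Fin p) ℝ) := by
  intro u v _
  rw [Matrix.one_apply]

lemma BlkUL.blkL {p n : ℕ} (e : ℕ → ℕ → Matrix (Fin p) (Fin p) ℝ) (α : ℕ) :
    BlkUL (blkL p n e α) := by
  rintro ⟨i, a⟩ ⟨j, b⟩ h
  have h : i ≤ j := h
  have h' : (i : ℕ) ≤ j := h
  have h2 : ¬ (i : ℕ) = j + 1 := by omega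
  by_cases hij : i = j <;> simp [_root_.blkL, hij, h2]

lemma BlkUL.list {p n : ℕ} (e : ℕ → ℕ → Matrix (Fin p) (Fin p) ℝ) (α k : ℕ) :
    BlkUL ((List.range k).map fun i => _root_.blkL p n e (α + i)).prod := by
  induction k with
  | zero => simpa using BlkUL.one
  | succ k ih =>
    rw [List.range_succ, List.map_append, List.prod_append]
    simpa using ih.mul (BlkUL.blkL e (α + k))

lemma BlkUL.det {p n : ℕ} {M : Matrix (Fin n × Fin p) (Fin n × Fin p) ℝ}
    (hM : BlkUL M) : M.det = 1 := by
  have hb : Mᵀ.BlockTriangular (Prod.fst : Fin n × Fin p → Fin n) := by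
    intro u v h
    have : v ≠ u := by rintro rfl; exact lt_irrefl _ h
    rw [Matrix.transpose_apply, hM v u (le_of_lt h), if_neg this]
  rw [← Matrix.det_transpose, hb.det_fintype]
  apply Finset.prod_eq_one
  intro k _
  have : Mᵀ.toSquareBlock Prod.fst k = 1 := by
    ext ⟨u, hu⟩ ⟨v, hv⟩
    rw [Matrix.toSquareBlock_def, Matrix.of_apply, Matrix.transpose_apply,
      hM v u (by rw [hu, hv]), Matrix.one_apply]
    simp [Subtype.ext_iff, eq_comm]
  rw [this, Matrix.det_one]

/-- Block upper triangular. -/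
def BlkUp {p n : ℕ} (M : Matrix (Fin n × Fin p) (Fin n × Fin p) ℝ) : Prop :=
  ∀ u v : Fin n × Fin p, v.1 < u.1 → M u v = 0

lemma BlkUp.mul {p n : ℕ} {M N : Matrix (Fin n × Fin p) (Fin n × Fin p) ℝ}
    (hM : BlkUp M) (hN : BlkUp N) : BlkUp (M * N) := by
  intro u v huv
  rw [Matrix.mul_apply]
  apply Finset.sum_eq_zero
  intro w _
  by_cases h : w.1 < u.1
  · rw [hM u w h, zero_mul]
  · rw [hN w v (lt_of_lt_of_le huv (not_lt.1 h)), mul_zero]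

lemma BlkUp.blkR {p n : ℕ} (q : ℕ → ℕ → Matrix (Fin p) (Fin p) ℝ) (α : ℕ) :
    BlkUp (blkR p n q α) := by
  rintro ⟨i, a⟩ ⟨j, b⟩ h
  have h : j < i := h
  have h' : (j : ℕ) < i := h
  have h2 : ¬ (j : ℕ) = i + 1 := by omega
  have h3 : ¬ i = j := h.ne'
  simp [_root_.blkR, h2, h3]

/-- The accumulated product `L^{(0)} ⋯ L^{(k-1)}`. -/
def blkP (p n : ℕ) (e : ℕ → ℕ → Matrix (Fin p) (Fin p) ℝ) (k : ℕ) :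
    Matrix (Fin n × Fin p) (Fin n × Fin p) ℝ :=
  ((List.range k).map fun i => blkL p n e (0 + i)).prod

lemma blkP_add (p n : ℕ) (e : ℕ → ℕ → Matrix (Fin p) (Fin p) ℝ) (k l : ℕ) :
    blkP p n e (k + l) = blkP p n e k * ((List.range l).map fun i => blkL p n e (k + i)).prod := by
  simp [blkP, List.range_add, Function.comp_def]

lemma blkJ_step {p n θ : ℕ} {q e : ℕ → ℕ → Matrix (Fin p) (Fin p) ℝ}
    (hbd : ∀ α : ℕ, e 0 α = 0 ∧ e n α = 0)
    (htoda : ∀ α : ℕ, TodaStep p θ q e n α) (α : ℕ) :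
    blkJ p n θ q e α * blkL p n e α = blkL p n e α * blkJ p n θ q e (α + 1) := by
  have h1 : ((List.range (θ + 1)).map fun i => blkL p n e (α + i)).prod
      = ((List.range θ).map fun i => blkL p n e (α + i)).prod * blkL p n e (α + θ) := by
    simp [List.range_succ]
  have h2 : ((List.range (θ + 1)).map fun i => blkL p n e (α + i)).prod
      = blkL p n e α * ((List.range θ).map fun i => blkL p n e (α + 1 + i)).prod := by
    simp [List.range_succ_eq_map, Function.comp_def, add_assoc, add_comm 1]
  rw [blkJ, blkJ, Matrix.mul_assoc, ← blk_toda_comm hbd htoda, ← Matrix.mul_assoc, ← h1, h2,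
    Matrix.mul_assoc]

lemma blkJ_conj {p n θ : ℕ} {q e : ℕ → ℕ → Matrix (Fin p) (Fin p) ℝ}
    (hbd : ∀ α : ℕ, e 0 α = 0 ∧ e n α = 0)
    (htoda : ∀ α : ℕ, TodaStep p θ q e n α) (α : ℕ) :
    blkJ p n θ q e 0 * blkP p n e α = blkP p n e α * blkJ p n θ q e α := by
  induction α with
  | zero => simp [blkP]
  | succ α ih =>
    rw [blkP_add]
    simp only [List.range_one, List.map_cons, List.map_nil, List.prod_cons, List.prod_nil,
      mul_one, add_zero]
    rw [← Matrix.mul_assoc, ih, Matrix.mul_assoc, blkJ_step hbd htoda, Matrix.mul_assoc]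

lemma blkJ_pow {p n θ : ℕ} {q e : ℕ → ℕ → Matrix (Fin p) (Fin p) ℝ}
    (hbd : ∀ α : ℕ, e 0 α = 0 ∧ e n α = 0)
    (htoda : ∀ α : ℕ, TodaStep p θ q e n α) (k : ℕ) :
    ∃ U, BlkUp U ∧ blkP p n e (θ * k) * U = blkJ p n θ q e 0 ^ k := by
  induction k with
  | zero =>
    refine ⟨1, ?_, by simp [blkP]⟩
    intro u v h
    have : u ≠ v := by rintro rfl; exact lt_irrefl _ h
    rw [Matrix.one_apply_ne this]
  | succ k ih =>
    obtain ⟨U, hU, h⟩ := ih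
    refine ⟨blkR p n q (θ * k) * U, (BlkUp.blkR q _).mul hU, ?_⟩
    rw [pow_succ', ← h, ← Matrix.mul_assoc (blkJ p n θ q e 0), blkJ_conj hbd htoda, mul_add,
      mul_one, blkP_add, blkJ]
    simp only [Matrix.mul_assoc]

/-- convergence of the generalized block qd-algorithm in the
simple spectrum case: `J_n^{(θα)}` tends to a block upper bidiagonal matrix. -/
theorem statement18 (p n θ : ℕ) (hp : 1 ≤ p) (hn : 1 ≤ n) (hθ : 1 ≤ θ)
    (q e : ℕ → ℕ → Matrix (Fin p) (Fin p) ℝ)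
    (hbd : ∀ α : ℕ, e 0 α = 0 ∧ e n α = 0)
    (htoda : ∀ α : ℕ, TodaStep p θ q e n α)
    (X : Matrix (Fin n × Fin p) (Fin n × Fin p) ℂ)
    (lam : Fin n × Fin p → ℂ)
    (hX : IsUnit X)
    (hdecomp : (blkJ p n θ q e 0).map (fun x : ℝ => (x : ℂ))
        = X * diagonal lam * X⁻¹)
    (hlam0 : ∀ u : Fin n × Fin p, lam u ≠ 0)
    (hlam : ∀ u v : Fin n × Fin p,
      (u.1 : ℕ) * p + (u.2 : ℕ) < (v.1 : ℕ) * p + (v.2 : ℕ) → ‖lam v‖ < ‖lam u‖)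
    (hprin : ∀ k : ℕ, 1 ≤ k → ∀ hk : k < n,
      IsUnit (X.submatrix
          (fun w : Fin k × Fin p => ((⟨(w.1 : ℕ), lt_trans w.1.2 hk⟩ : Fin n), w.2))
          (fun w : Fin k × Fin p => ((⟨(w.1 : ℕ), lt_trans w.1.2 hk⟩ : Fin n), w.2))) ∧
      IsUnit ((X⁻¹).submatrix
          (fun w : Fin k × Fin p => ((⟨(w.1 : ℕ), lt_trans w.1.2 hk⟩ : Fin n), w.2))
          (fun w : Fin k × Fin p => ((⟨(w.1 : ℕ), lt_trans w.1.2 hk⟩ : Fin n), w.2)))) :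
    (∀ i j : Fin n, (j : ℕ) < (i : ℕ) →
      Tendsto
        (fun α : ℕ => Matrix.of fun a b : Fin p => blkJ p n θ q e (θ * α) (i, a) (j, b))
        atTop (nhds (0 : Matrix (Fin p) (Fin p) ℝ))) ∧
    (∀ α : ℕ, ∀ i j : Fin n, (i : ℕ) + 1 < (j : ℕ) → ∀ a b : Fin p,
      blkJ p n θ q e (θ * α) (i, a) (j, b) = 0) ∧
    (∀ α : ℕ, ∀ i j : Fin n, (j : ℕ) = (i : ℕ) + 1 → ∀ a b : Fin p,
      blkJ p n θ q e (θ * α) (i, a) (j, b) = if a = b then 1 else 0) ∧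
    (∀ m : ℕ, 1 ≤ m → m ≤ n → ∃ qlim : Matrix (Fin p) (Fin p) ℝ,
      Tendsto (fun α : ℕ => q m (θ * α)) atTop (nhds qlim)) := by
  classical
  have hXd : IsUnit X.det := (Matrix.isUnit_iff_isUnit_det _).1 hX
  have hPUL : ∀ k, BlkUL (blkP p n e k) := fun k => BlkUL.list e 0 k
  choose U hU hPU using fun k => blkJ_pow (p := p) (n := n) (θ := θ) (q := q) (e := e) hbd htoda k
  let φ : Matrix (Fin n × Fin p) (Fin n × Fin p) ℝ →+* Matrix (Fin n × Fin p) (Fin n × Fin p) ℂ :=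
    (Complex.ofRealHom : ℝ →+* ℂ).mapMatrix
  have hφ : ∀ M u v, φ M u v = (M u v : ℂ) := fun _ _ _ => rfl
  have hA : φ (blkJ p n θ q e 0) = X * diagonal lam * X⁻¹ := hdecomp
  have hApow : ∀ k, φ (blkJ p n θ q e 0) ^ k = X * diagonal lam ^ k * X⁻¹ := by
    intro k
    rw [hA]
    induction k with
    | zero => simp [Matrix.mul_nonsing_inv _ hXd]
    | succ k ih =>
      rw [pow_succ, ih, pow_succ]
      calc X * diagonal lam ^ k * X⁻¹ * (X * diagonal lam * X⁻¹)
          = X * diagonal lam ^ k * (X⁻¹ * X) * diagonal lam * X⁻¹ := by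
            simp only [Matrix.mul_assoc]
        _ = _ := by rw [Matrix.nonsing_inv_mul _ hXd]; simp only [Matrix.mul_assoc, Matrix.one_mul]
  -- entrywise convergence of the accumulated products
  have hconv : ∀ u v, ∃ l, Tendsto (fun k => blkP p n e (θ * k) u v) atTop (nhds l) := by
    intro u v
    by_cases hv : (v.1 : ℕ) + 1 < n
    · obtain ⟨hx, hy⟩ := hprin (v.1 + 1) (by omega) hv
      set f : Fin ((v.1 : ℕ) + 1) × Fin p → Fin n × Fin p :=
        fun w => ((⟨(w.1 : ℕ), lt_trans w.1.2 hv⟩ : Fin n), w.2) with hf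
      have hrange : ∀ u, u ∉ Set.range f → v.1 < u.1 := by
        intro u hu
        by_contra h
        have h' : (u.1 : ℕ) ≤ v.1 := not_lt.1 h
        exact hu ⟨(⟨u.1, by omega⟩, u.2), rfl⟩
      have hfle : ∀ w, (f w).1 ≤ v.1 := by
        intro w
        have := w.1.2
        change ((f w).1 : ℕ) ≤ v.1
        simp only [hf]; omega
      have hinj : Function.Injective f := by
        rintro ⟨a, b⟩ ⟨c, d⟩ h
        simp only [hf, Prod.mk.injEq, Fin.mk.injEq] at h
        exact Prod.ext (Fin.ext h.1) h.2
      let w : Fin ((v.1 : ℕ) + 1) × Fin p := (⟨v.1, by omega⟩, v.2)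
      have hfw : f w = v := rfl
      obtain ⟨l, hl⟩ := blk_conv_aux f X X⁻¹ lam hlam0
        (by
          intro u hu w
          apply hlam
          have h1 : ((f w).1 : ℕ) < u.1 := lt_of_le_of_lt (hfle w) (hrange u hu)
          have h2 := (f w).2.2
          have h3 : (((f w).1 : ℕ) + 1) * p ≤ u.1 * p := Nat.mul_le_mul_right _ h1
          rw [add_mul] at h3
          omega)
        hinj hx hy (fun k => φ (blkP p n e (θ * k))) (fun k => φ (U k))
        (by
          intro k u hu w
          rw [hφ, hU k u (f w) (lt_of_le_of_lt (hfle w) (hrange u hu))]; simp)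
        (by intro k; rw [← map_mul, hPU, map_pow, hApow])
        w
        (by
          intro k w'
          rw [hφ, hPUL _ _ _ (by rw [hfw]; exact hfle w')]
          by_cases h : w' = w
          · simp [h]
          · have h' : f w' ≠ f w := fun h2 => h (hinj h2)
            simp [h, h'])
        u
      refine ⟨l.re, ?_⟩
      exact (Complex.continuous_re.tendsto l).comp hl
    · have : u.1 ≤ v.1 := by
        have := u.1.2
        change (u.1 : ℕ) ≤ v.1
        omega
      simp only [hPUL _ u v this]
      exact ⟨_, tendsto_const_nhds⟩
  choose Pl hPl using hconv
  let Pi : Matrix (Fin n × Fin p) (Fin n × Fin p) ℝ := Matrix.of Pl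
  have hPt : Tendsto (fun k => blkP p n e (θ * k)) atTop (nhds Pi) :=
    tendsto_pi_nhds.2 fun u => tendsto_pi_nhds.2 fun v => hPl u v
  have hPid : Pi.det = 1 := by
    have h := ((continuous_id.matrix_det).tendsto Pi).comp hPt
    refine tendsto_nhds_unique h ?_
    refine tendsto_const_nhds.congr fun k => ?_
    exact ((hPUL _).det).symm
  have hadj : Tendsto (fun k => (blkP p n e (θ * k)).adjugate) atTop (nhds Pi.adjugate) :=
    ((continuous_id.matrix_adjugate).tendsto Pi).comp hPt
  have hJ : ∀ k, blkJ p n θ q e (θ * k)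
      = (blkP p n e (θ * k)).adjugate * (blkJ p n θ q e 0 * blkP p n e (θ * k)) := by
    intro k
    rw [blkJ_conj hbd htoda, ← Matrix.mul_assoc, Matrix.adjugate_mul, (hPUL _).det]
    simp
  let Ji := Pi.adjugate * (blkJ p n θ q e 0 * Pi)
  have hJt : Tendsto (fun k => blkJ p n θ q e (θ * k)) atTop (nhds Ji) := by
    simp only [hJ]
    exact hadj.mul (tendsto_const_nhds.mul hPt)
  let Lam : ℕ → Matrix (Fin n × Fin p) (Fin n × Fin p) ℝ := fun k =>
    ((List.range θ).map fun i => blkL p n e (θ * k + i)).prod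
  have hLamd : ∀ k, (Lam k).det = 1 := fun k => (BlkUL.list e _ _).det
  have hLam : ∀ k, Lam k = (blkP p n e (θ * k)).adjugate * blkP p n e (θ * (k + 1)) := by
    intro k
    rw [mul_add, mul_one, blkP_add, ← Matrix.mul_assoc, Matrix.adjugate_mul, (hPUL _).det]
    simp [Lam]
  have hLamt : Tendsto Lam atTop (nhds 1) := by
    have h : Tendsto (fun k => (blkP p n e (θ * k)).adjugate * blkP p n e (θ * (k + 1))) atTop
        (nhds (Pi.adjugate * Pi)) := hadj.mul (hPt.comp (tendsto_add_atTop_nat 1))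
    rw [Matrix.adjugate_mul, hPid, one_smul] at h
    exact h.congr fun k => (hLam k).symm
  have hR : ∀ k, blkR p n q (θ * k) = (Lam k).adjugate * blkJ p n θ q e (θ * k) := by
    intro k
    change _ = (Lam k).adjugate * (Lam k * _)
    rw [← Matrix.mul_assoc, Matrix.adjugate_mul, hLamd]
    simp
  have hRt : Tendsto (fun k => blkR p n q (θ * k)) atTop (nhds Ji) := by
    simp only [hR]
    have h := (((continuous_id.matrix_adjugate).tendsto
      (1 : Matrix (Fin n × Fin p) (Fin n × Fin p) ℝ)).comp hLamt)
    have h2 := h.mul hJt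
    simpa using h2
  have hJe : ∀ u v, Tendsto (fun k => blkJ p n θ q e (θ * k) u v) atTop (nhds (Ji u v)) :=
    fun u v => tendsto_pi_nhds.1 (tendsto_pi_nhds.1 hJt u) v
  have hRe : ∀ u v, Tendsto (fun k => blkR p n q (θ * k) u v) atTop (nhds (Ji u v)) :=
    fun u v => tendsto_pi_nhds.1 (tendsto_pi_nhds.1 hRt u) v
  -- the exact superdiagonal structure
  have hup : ∀ (α : ℕ) (i j : Fin n), (i : ℕ) + 1 ≤ (j : ℕ) → ∀ a b : Fin p,
      blkJ p n θ q e (θ * α) (i, a) (j, b) = blkR p n q (θ * α) (i, a) (j, b) := by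
    intro α i j hij a b
    change (Lam α * blkR p n q (θ * α)) _ _ = _
    rw [Matrix.mul_apply, Finset.sum_eq_single (i, a)]
    · rw [show Lam α (i, a) (i, a) = _ from BlkUL.list e _ _ _ _ le_rfl]; simp
    · rintro ⟨c, d⟩ _ hne
      by_cases h : i ≤ c
      · rw [show Lam α (i, a) (c, d) = _ from BlkUL.list e _ _ _ _ h, if_neg hne.symm, zero_mul]
      · have h' : (c : ℕ) < i := not_le.1 h
        have n1 : ¬ c = j := fun h => by rw [h] at h'; omega
        have n2 : ¬ (j : ℕ) = c + 1 := by omega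
        simp [blkR, n1, n2]
    · simp
  refine ⟨?_, ?_, ?_, ?_⟩
  · intro i j hij
    refine tendsto_pi_nhds.2 fun a => tendsto_pi_nhds.2 fun b => ?_
    have h0 : Ji (i, a) (j, b) = 0 := by
      refine tendsto_nhds_unique (hRe (i, a) (j, b)) ?_
      refine tendsto_const_nhds.congr fun k => ?_
      exact (BlkUp.blkR q _ (i, a) (j, b) hij).symm
    have := hJe (i, a) (j, b)
    rw [h0] at this
    exact this
  · intro α i j hij a b
    rw [hup α i j hij.le]
    have n1 : ¬ i = j := fun h => by rw [h] at hij; omega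
    have n2 : ¬ (j : ℕ) = i + 1 := by omega
    simp [blkR, n1, n2]
  · intro α i j hij a b
    rw [hup α i j hij.ge]
    have n1 : ¬ i = j := fun h => by rw [h] at hij; omega
    simp [blkR, n1, hij]
  · intro m hm1 hmn
    let i : Fin n := ⟨m - 1, by omega⟩
    refine ⟨Matrix.of fun a b => Ji (i, a) (i, b), ?_⟩
    refine tendsto_pi_nhds.2 fun a => tendsto_pi_nhds.2 fun b => ?_
    refine (hRe (i, a) (i, b)).congr fun k => ?_
    have : m - 1 + 1 = m := by omega
    simp [blkR, i, this]
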